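/- arXiv:2302.05951 — 3 statements merged into one kernel-verified Lean document; each statement's English description precedes it below -/
import Mathlib

section
/- Let G be a finite simple graph on a vertex set V and let k ≥ 1 be an integer. Set G₁ := G and, for i = 1, …, k, let F_i be a spanning forest of G_i and let G_{i+1} be G_i with the edges of F_i removed. Then for every S ⊆ V and every i with 0 ≤ i ≤ k, the subgraph F₁ ∪ … ∪ F_i has at least min(i, |∂_G(S)|) edges with exactly one endpoint in S. -/
open scoped Classical

/-- The edge boundary of a vertex set `S` in a simple graph `G`: the set of edges of `G`
with exactly one endpoint in `S`. -/
noncomputable def edgeBoundary {V : Type*} [Fintype V] (G : SimpleGraph V) (S : Finset V) :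
    Finset (Sym2 V) :=
  Finset.univ.filter (fun e => e ∈ G.edgeSet ∧ ∃ v w, e = s(v, w) ∧ v ∈ S ∧ w ∉ S)

/-- `F` is a spanning forest of `G`: a subgraph of `G` that is acyclic and preserves
reachability. -/
def IsSpanningForest {V : Type*} (G F : SimpleGraph V) : Prop :=
  F ≤ G ∧ F.IsAcyclic ∧ ∀ u v : V, G.Reachable u v → F.Reachable u v

theorem mem_edgeBoundary {V : Type*} [Fintype V] {G : SimpleGraph V} {S : Finset V}
    {e : Sym2 V} :
    e ∈ edgeBoundary G S ↔ e ∈ G.edgeSet ∧ ∃ v w, e = s(v, w) ∧ v ∈ S ∧ w ∉ S := by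
  simp [edgeBoundary]

theorem edgeBoundary_mono {V : Type*} [Fintype V] {G H : SimpleGraph V} (h : G ≤ H)
    (S : Finset V) : edgeBoundary G S ⊆ edgeBoundary H S := by
  intro e he
  rw [mem_edgeBoundary] at he ⊢
  exact ⟨SimpleGraph.edgeSet_mono h he.1, he.2⟩

/-- A spanning forest crosses every cut that the graph crosses. -/
theorem IsSpanningForest.edgeBoundary_nonempty {V : Type*} [Fintype V] {G F : SimpleGraph V}
    (hF : IsSpanningForest G F) {S : Finset V} (hS : (edgeBoundary G S).Nonempty) :
    (edgeBoundary F S).Nonempty := by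
  obtain ⟨e, he⟩ := hS
  obtain ⟨hadj, v, w, rfl, hv, hw⟩ := mem_edgeBoundary.1 he
  obtain ⟨p⟩ := hF.2.2 v w (SimpleGraph.Adj.reachable hadj)
  obtain ⟨d, -, hd₁, hd₂⟩ := p.exists_boundary_dart (S : Set V) hv hw
  exact ⟨s(d.fst, d.snd), mem_edgeBoundary.2 ⟨d.adj, _, _, rfl, hd₁, hd₂⟩⟩

/-- Adding a spanning forest of `G \ U` to `U` gains a boundary edge, unless `U` already
contains the whole boundary. -/
theorem min_succ_le_card_edgeBoundary_sup {V : Type*} [Fintype V] {G U F : SimpleGraph V}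
    (hF : IsSpanningForest (G \ U) F) {S : Finset V} {n : ℕ}
    (hU : min n (edgeBoundary G S).card ≤ (edgeBoundary U S).card) :
    min (n + 1) (edgeBoundary G S).card ≤ (edgeBoundary (U ⊔ F) S).card := by
  have hUF : edgeBoundary U S ⊆ edgeBoundary (U ⊔ F) S := edgeBoundary_mono le_sup_left S
  by_cases hsub : edgeBoundary G S ⊆ edgeBoundary U S
  · exact (min_le_right _ _).trans (Finset.card_le_card (hsub.trans hUF))
  · obtain ⟨e, heG, heU⟩ := Finset.not_subset.1 hsub
    rw [mem_edgeBoundary] at heG heU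
    have hne : (edgeBoundary (G \ U) S).Nonempty := by
      refine ⟨e, mem_edgeBoundary.2 ⟨?_, heG.2⟩⟩
      rw [SimpleGraph.edgeSet_sdiff]
      exact ⟨heG.1, fun h => heU ⟨h, heG.2⟩⟩
    obtain ⟨f, hf⟩ := hF.edgeBoundary_nonempty hne
    have hfU : f ∉ edgeBoundary U S := by
      intro h
      have hfGU := SimpleGraph.edgeSet_mono hF.1 (mem_edgeBoundary.1 hf).1
      rw [SimpleGraph.edgeSet_sdiff] at hfGU
      exact hfGU.2 (mem_edgeBoundary.1 h).1
    have hlt : (edgeBoundary U S).card < (edgeBoundary (U ⊔ F) S).card :=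
      Finset.card_lt_card <| Finset.ssubset_iff_of_subset hUF |>.2
        ⟨f, edgeBoundary_mono le_sup_right S hf, hfU⟩
    omega

theorem iSup_Icc_one_succ {α : Type*} [CompleteLattice α] (f : ℕ → α) (i : ℕ) :
    ⨆ j ∈ Finset.Icc 1 (i + 1), f j = (⨆ j ∈ Finset.Icc 1 i, f j) ⊔ f (i + 1) := by
  rw [← Finset.insert_Icc_right_eq_Icc_add_one (by omega), Finset.iSup_insert, sup_comm]

theorem nested_spanning_forests_boundary_lower_bound
    {V : Type*} [Fintype V] (G : SimpleGraph V) (k : ℕ) (hk : 1 ≤ k)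
    (Gs F : ℕ → SimpleGraph V) (hG1 : Gs 1 = G)
    (hF : ∀ i, 1 ≤ i → i ≤ k → IsSpanningForest (Gs i) (F i))
    (hGs : ∀ i, 1 ≤ i → i ≤ k → Gs (i + 1) = Gs i \ F i) :
    ∀ (S : Finset V) (i : ℕ), i ≤ k →
      min i (edgeBoundary G S).card ≤
        (edgeBoundary (⨆ j ∈ Finset.Icc 1 i, F j) S).card := by
  have hrem : ∀ i ≤ k, Gs (i + 1) = G \ ⨆ j ∈ Finset.Icc 1 i, F j := by
    intro i
    induction i with
    | zero => simp [hG1]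
    | succ i ih =>
      intro hi
      rw [hGs (i + 1) (by omega) hi, ih (by omega), iSup_Icc_one_succ, sdiff_sdiff]
  intro S i
  induction i with
  | zero => simp
  | succ i ih =>
    intro hi
    have hFi := hF (i + 1) (by omega) hi
    rw [hrem i (by omega)] at hFi
    rw [iSup_Icc_one_succ]
    exact min_succ_le_card_edgeBoundary_sup hFi (ih (by omega))
end

section
/- Let G be a finite simple graph on a vertex set V with |V| ≥ 2, with minimum degree δ(G), and let 𝒫 be a partition of V such that every non-singleton minimum cut C of G (i.e. a cut with min(|C|, |V ∖ C|) ≥ 2 and |∂_G(C)| = λ(G)) is respected by 𝒫, meaning every part P ∈ 𝒫 satisfies P ⊆ C or P ∩ C = ∅. Then λ(G) = min( δ(G), min { |∂_G(C)| : C is a cut of G that is a union of parts of 𝒫 } ), where the inner minimum is taken to be +∞ (i.e. ignored) if no cut of G is a union of parts of 𝒫. -/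
open scoped Classical

/-- The edge connectivity of `G`: the minimum size of the edge boundary over all cuts,
i.e. over all vertex sets `S` with `∅ ⊊ S ⊊ V`. -/
noncomputable def edgeConn {V : Type*} [Fintype V] (G : SimpleGraph V) : ℕ :=
  sInf {n | ∃ S : Finset V, S.Nonempty ∧ S ≠ Finset.univ ∧ (edgeBoundary G S).card = n}

/-- The minimum vertex degree of `G`. -/
noncomputable def minDeg {V : Type*} [Fintype V] (G : SimpleGraph V) : ℕ :=
  sInf {n | ∃ v : V, G.degree v = n}

/-- `C` is a non-singleton minimum cut of `G`: both sides have at least two vertices and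
the boundary attains the edge connectivity. -/
noncomputable def IsNonsingletonMinCut {V : Type*} [Fintype V] (G : SimpleGraph V)
    (C : Finset V) : Prop :=
  2 ≤ C.card ∧ 2 ≤ (Finset.univ \ C).card ∧ (edgeBoundary G C).card = edgeConn G

theorem edgeBoundary_compl {V : Type*} [Fintype V] (G : SimpleGraph V) (S : Finset V) :
    edgeBoundary G Sᶜ = edgeBoundary G S := by
  ext e
  simp only [mem_edgeBoundary, Finset.mem_compl, not_not]
  refine and_congr_right fun _ => ⟨?_, ?_⟩ <;>
  · rintro ⟨v, w, rfl, hv, hw⟩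
    exact ⟨w, v, Sym2.eq_swap, hw, hv⟩

theorem card_edgeBoundary_singleton {V : Type*} [Fintype V] (G : SimpleGraph V) (v : V) :
    (edgeBoundary G {v}).card = G.degree v := by
  rw [← G.card_incidenceFinset_eq_degree v]
  congr 1
  ext e
  simp only [mem_edgeBoundary, SimpleGraph.mem_incidenceFinset, SimpleGraph.incidenceSet,
    Set.mem_ofPred_eq, Finset.mem_singleton]
  refine and_congr_right fun he => ⟨?_, fun hv => ?_⟩
  · rintro ⟨_, w, rfl, rfl, -⟩
    exact Sym2.mem_mk_left _ w
  · obtain ⟨w, rfl⟩ := hv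
    exact ⟨v, w, rfl, rfl, (G.ne_of_adj he).symm⟩

theorem edgeConn_le_card_edgeBoundary {V : Type*} [Fintype V] (G : SimpleGraph V)
    {S : Finset V} (hS : S.Nonempty) (hS' : S ≠ Finset.univ) :
    edgeConn G ≤ (edgeBoundary G S).card :=
  Nat.sInf_le ⟨S, hS, hS', rfl⟩

theorem exists_card_edgeBoundary_eq_edgeConn {V : Type*} [Fintype V]
    (hV : 2 ≤ Fintype.card V) (G : SimpleGraph V) :
    ∃ S : Finset V, S.Nonempty ∧ S ≠ Finset.univ ∧
      (edgeBoundary G S).card = edgeConn G := by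
  have : Nontrivial V := Fintype.one_lt_card_iff_nontrivial.mp hV
  obtain ⟨v⟩ : Nonempty V := inferInstance
  exact Nat.sInf_mem (s := {n | ∃ S : Finset V, S.Nonempty ∧ S ≠ Finset.univ ∧
    (edgeBoundary G S).card = n})
    ⟨_, {v}, Finset.singleton_nonempty v, Finset.singleton_ne_univ v, rfl⟩

theorem edgeConn_le_minDeg {V : Type*} [Fintype V] (hV : 2 ≤ Fintype.card V)
    (G : SimpleGraph V) : edgeConn G ≤ minDeg G := by
  have : Nontrivial V := Fintype.one_lt_card_iff_nontrivial.mp hV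
  obtain ⟨u⟩ : Nonempty V := inferInstance
  obtain ⟨v, hv⟩ : ∃ v : V, G.degree v = minDeg G :=
    Nat.sInf_mem (s := {n | ∃ v : V, G.degree v = n}) ⟨_, u, rfl⟩
  rw [← hv, ← card_edgeBoundary_singleton]
  exact edgeConn_le_card_edgeBoundary G (Finset.singleton_nonempty v)
    (Finset.singleton_ne_univ v)

theorem minDeg_le_card_edgeBoundary_of_card_eq_one {V : Type*} [Fintype V]
    (G : SimpleGraph V) {S : Finset V} (hS : S.card = 1) :
    minDeg G ≤ (edgeBoundary G S).card := by
  obtain ⟨v, rfl⟩ := Finset.card_eq_one.mp hS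
  exact Nat.sInf_le ⟨v, (card_edgeBoundary_singleton G v).symm⟩

/-- A set respected by a partition is the union of the parts it contains. -/
theorem Finpartition.eq_sup_filter_subset {V : Type*} [Fintype V]
    (P : Finpartition (Finset.univ : Finset V)) {C : Finset V}
    (hC : ∀ p ∈ P.parts, p ⊆ C ∨ p ∩ C = ∅) :
    C = (P.parts.filter (· ⊆ C)).sup id := by
  refine le_antisymm (fun x hx => ?_) (Finset.sup_le fun p hp => (Finset.mem_filter.mp hp).2)
  obtain ⟨p, hp, hxp⟩ := P.exists_mem (Finset.mem_univ x)
  refine Finset.mem_sup.mpr ⟨p, Finset.mem_filter.mpr ⟨hp, ?_⟩, hxp⟩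
  refine (hC p hp).resolve_right fun h => ?_
  exact Finset.notMem_empty x (h ▸ Finset.mem_inter.mpr ⟨hxp, hx⟩)

theorem edge_connectivity_from_contraction
    {V : Type*} [Fintype V] (hV : 2 ≤ Fintype.card V) (G : SimpleGraph V)
    (P : Finpartition (Finset.univ : Finset V))
    (hresp : ∀ C : Finset V, IsNonsingletonMinCut G C →
      ∀ p ∈ P.parts, p ⊆ C ∨ p ∩ C = ∅) :
    (edgeConn G : ℕ∞) =
      min (minDeg G : ℕ∞)
        (sInf {n : ℕ∞ | ∃ C : Finset V, C.Nonempty ∧ C ≠ Finset.univ ∧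
          (∃ Q ⊆ P.parts, C = Q.sup id) ∧ ((edgeBoundary G C).card : ℕ∞) = n}) := by
  apply le_antisymm
  · refine le_min (Nat.cast_le.mpr (edgeConn_le_minDeg hV G)) (le_sInf ?_)
    rintro _ ⟨C, hC, hC', -, rfl⟩
    exact Nat.cast_le.mpr (edgeConn_le_card_edgeBoundary G hC hC')
  · obtain ⟨C, hC, hC', hmin⟩ := exists_card_edgeBoundary_eq_edgeConn hV G
    have hpos : 0 < C.card := hC.card_pos
    have hpos' : 0 < Cᶜ.card := Finset.card_pos.mpr <| by
      rwa [Finset.nonempty_iff_ne_empty, ne_eq, Finset.compl_eq_empty_iff]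
    by_cases h1 : C.card = 1
    · refine min_le_of_left_le (Nat.cast_le.mpr ?_)
      exact hmin ▸ minDeg_le_card_edgeBoundary_of_card_eq_one G h1
    by_cases h2 : Cᶜ.card = 1
    · refine min_le_of_left_le (Nat.cast_le.mpr ?_)
      rw [← hmin, ← edgeBoundary_compl]
      exact minDeg_le_card_edgeBoundary_of_card_eq_one G h2
    · refine min_le_of_right_le (sInf_le ⟨C, hC, hC', ?_, congrArg _ hmin⟩)
      refine ⟨_, Finset.filter_subset _ _, P.eq_sup_filter_subset (hresp C ⟨?_, ?_, hmin⟩)⟩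
      · omega
      · rw [← Finset.compl_eq_univ_sdiff]
        omega
end

section
/- Let φ > 0 and let G be a finite simple graph on a vertex set V with m edges that is a φ-expander. Let e₁, …, e_k be distinct edges of G with k ≤ φ·vol_G(V)/20 = φ·(2m)/20, and for 0 ≤ i ≤ k let G_i be G with the edges e₁, …, e_i removed. Then there exist sets ∅ = P₀ ⊆ P₁ ⊆ … ⊆ P_k ⊆ V such that for every 1 ≤ i ≤ k: (a) vol_G(P_i) ≤ 8i/φ, (b) the number of edges of G_i with exactly one endpoint in P_i is at most 4i, and (c) the induced subgraph G_i[V ∖ P_i] is a (φ/6)-expander: for every S with ∅ ⊊ S ⊊ V ∖ P_i, the number of edges of G_i[V ∖ P_i] between S and (V ∖ P_i) ∖ S is at least (φ/6)·min(vol_{G_i[V∖P_i]}(S), vol_{G_i[V∖P_i]}((V ∖ P_i) ∖ S)). -/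
open scoped Classical

/-- The degree of `v` in the induced subgraph `G[U]`. -/
noncomputable def degIn {V : Type*} [Fintype V] (G : SimpleGraph V) (U : Finset V) (v : V) :
    ℕ :=
  (G.neighborFinset v ∩ U).card

/-- The volume of `S` in the induced subgraph `G[U]`. -/
noncomputable def volIn {V : Type*} [Fintype V] (G : SimpleGraph V) (U S : Finset V) : ℕ :=
  ∑ v ∈ S, degIn G U v

/-- The set of edges of the induced subgraph `G[U]` with one endpoint in `S` and the other
in `U \ S`. -/
noncomputable def crossIn {V : Type*} [Fintype V] (G : SimpleGraph V) (U S : Finset V) :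
    Finset (Sym2 V) :=
  Finset.univ.filter (fun e => e ∈ G.edgeSet ∧ ∃ v w, e = s(v, w) ∧ v ∈ S ∧ w ∈ U \ S)

lemma volIn_union_left {V : Type*} [Fintype V] (G : SimpleGraph V) (U : Finset V)
    {S T : Finset V} (h : Disjoint S T) : volIn G U (S ∪ T) = volIn G U S + volIn G U T :=
  Finset.sum_union h

lemma volIn_eq_card {V : Type*} [Fintype V] (G : SimpleGraph V) (U S : Finset V) :
    volIn G U S = ((S ×ˢ U).filter fun p => G.Adj p.1 p.2).card := by
  rw [Finset.card_filter, Finset.sum_product]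
  refine Finset.sum_congr rfl fun a _ => ?_
  rw [degIn, ← Finset.card_filter]
  congr 1
  ext b
  simp [and_comm]

lemma volIn_comm {V : Type*} [Fintype V] (G : SimpleGraph V) (U S : Finset V) :
    volIn G U S = volIn G S U := by
  rw [volIn_eq_card, volIn_eq_card]
  refine Finset.card_bij (fun p _ => p.swap) ?_ ?_ ?_
  · rintro ⟨a, b⟩ h
    simp only [Finset.mem_filter, Finset.mem_product, Prod.swap_prod_mk] at h ⊢
    exact ⟨h.1.symm, h.2.symm⟩
  · exact fun _ _ _ _ h => Prod.swap_injective h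
  · rintro ⟨a, b⟩ h
    simp only [Finset.mem_filter, Finset.mem_product] at h
    exact ⟨(b, a), by simp [h, h.2.symm], rfl⟩

lemma volIn_union_right {V : Type*} [Fintype V] (G : SimpleGraph V) {U W : Finset V}
    (h : Disjoint U W) (S : Finset V) : volIn G (U ∪ W) S = volIn G U S + volIn G W S := by
  rw [volIn_comm, volIn_union_left G S h, volIn_comm, volIn_comm G S W]

lemma volIn_mono {V : Type*} [Fintype V] {H G : SimpleGraph V} (hle : H ≤ G)
    {U U' S S' : Finset V} (hU : U ⊆ U') (hS : S ⊆ S') : volIn H U S ≤ volIn G U' S' := by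
  rw [volIn_eq_card, volIn_eq_card]
  refine Finset.card_le_card fun p hp => ?_
  simp only [Finset.mem_filter, Finset.mem_product] at hp ⊢
  exact ⟨⟨hS hp.1.1, hU hp.1.2⟩, hle hp.2⟩

lemma card_crossIn {V : Type*} [Fintype V] (G : SimpleGraph V) (U S : Finset V) :
    (crossIn G U S).card = volIn G (U \ S) S := by
  rw [volIn_eq_card]
  symm
  refine Finset.card_bij (fun p _ => s(p.1, p.2)) ?_ ?_ ?_
  · rintro ⟨a, b⟩ h
    simp only [Finset.mem_filter, Finset.mem_product] at h
    simp only [crossIn, Finset.mem_filter, Finset.mem_univ, true_and, SimpleGraph.mem_edgeSet]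
    exact ⟨h.2, a, b, rfl, h.1⟩
  · rintro ⟨a, b⟩ h ⟨c, d⟩ h' heq
    simp only [Finset.mem_filter, Finset.mem_product, Finset.mem_sdiff] at h h'
    rcases Sym2.eq_iff.1 heq with ⟨h1, h2⟩ | ⟨h1, h2⟩
    · exact Prod.ext h1 h2
    · dsimp only at h1 h2
      subst h1 h2
      exact absurd h.1.1 h'.1.2.2
  · intro s hs
    simp only [crossIn, Finset.mem_filter, Finset.mem_univ, true_and] at hs
    obtain ⟨hs, v, w, rfl, hv, hw⟩ := hs
    exact ⟨(v, w), by simpa [hv] using ⟨Finset.mem_sdiff.1 hw, hs⟩, rfl⟩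

lemma card_edgeBoundary {V : Type*} [Fintype V] (G : SimpleGraph V) (S : Finset V) :
    (edgeBoundary G S).card = volIn G (Finset.univ \ S) S := by
  rw [← card_crossIn]
  congr 1
  ext s
  simp [edgeBoundary, crossIn]

lemma volIn_le_deleteEdges {V : Type*} [Fintype V] (G : SimpleGraph V) (D : Finset (Sym2 V))
    (U S : Finset V) : volIn G U S ≤ volIn (G.deleteEdges D) U S + 2 * D.card := by
  rw [volIn_eq_card, volIn_eq_card]
  have hfib (s : Sym2 V) :
      ((Finset.univ : Finset (V × V)).filter fun p => s(p.1, p.2) = s).card ≤ 2 := by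
    induction s using Sym2.ind with
    | _ x y =>
      refine (Finset.card_le_card (t := {(x, y), (y, x)}) ?_).trans Finset.card_le_two
      rintro ⟨a, b⟩ h
      simpa using h
  have hsub : ((S ×ˢ U).filter fun p => G.Adj p.1 p.2) ⊆
      ((S ×ˢ U).filter fun p => (G.deleteEdges D).Adj p.1 p.2) ∪
        D.biUnion fun s => Finset.univ.filter fun p : V × V => s(p.1, p.2) = s := by
    rintro ⟨a, b⟩ h
    simp only [Finset.mem_filter, Finset.mem_product] at h
    by_cases hD : s(a, b) ∈ D <;> simp [h, hD, SimpleGraph.deleteEdges_adj]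
  calc _ ≤ _ := Finset.card_le_card hsub
    _ ≤ _ := Finset.card_union_le _ _
    _ ≤ _ := by
      gcongr
      rw [mul_comm]
      exact Finset.card_biUnion_le_card_mul _ _ _ fun s _ => hfib s

lemma volIn_univ_univ {V : Type*} [Fintype V] (G : SimpleGraph V) :
    volIn G Finset.univ Finset.univ = 2 * G.edgeFinset.card := by
  rw [← G.sum_degrees_eq_twice_card_edges]
  simp [volIn, degIn]

/-- The expansion hypothesis on `G`, with boundaries counted as ordered pairs. -/
def IsVolExpander {V : Type*} [Fintype V] (G : SimpleGraph V) (φ : ℝ) : Prop :=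
  ∀ S : Finset V, S.Nonempty → S ≠ Finset.univ →
    φ * min ((volIn G Finset.univ S : ℝ)) ((volIn G Finset.univ (Finset.univ \ S) : ℝ)) ≤
      (volIn G (Finset.univ \ S) S : ℝ)

lemma IsVolExpander.le_one {V : Type*} [Fintype V] {G : SimpleGraph V} {φ : ℝ}
    (hexp : IsVolExpander G φ) {u v : V} (huv : G.Adj u v) : φ ≤ 1 := by
  have hne : ({u} : Finset V) ≠ Finset.univ := fun h => by
    have : v ∈ ({u} : Finset V) := h ▸ Finset.mem_univ v
    exact huv.ne (Finset.mem_singleton.1 this).symm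
  have h := hexp {u} (Finset.singleton_nonempty u) hne
  have hself : volIn G {u} {u} = 0 := by simp [volIn, degIn]
  have hsplit : volIn G Finset.univ {u} = volIn G (Finset.univ \ {u}) {u} := by
    have := volIn_union_right G (Finset.sdiff_disjoint (s := {u}) (t := Finset.univ)) {u}
    rwa [Finset.sdiff_union_of_subset (Finset.subset_univ _), hself, add_zero] at this
  have hle : volIn G Finset.univ {u} ≤ volIn G Finset.univ (Finset.univ \ {u}) := by
    rw [hsplit, volIn_comm]
    exact volIn_mono le_rfl (Finset.subset_univ _) subset_rfl
  have hpos : 0 < volIn G Finset.univ {u} := by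
    rw [volIn_eq_card, Finset.card_pos]
    exact ⟨(u, v), by simp [huv]⟩
  rw [min_eq_left (by exact_mod_cast hle), ← hsplit] at h
  have hpos' : (0 : ℝ) < volIn G Finset.univ {u} := by exact_mod_cast hpos
  exact le_of_mul_le_mul_right (by linarith) hpos'

/-- `P` is a sparse cut of `H` containing at most half of the volume of `G`. -/
def IsPrunable {V : Type*} [Fintype V] (G H : SimpleGraph V) (φ : ℝ) (P : Finset V) : Prop :=
  (volIn H (Finset.univ \ P) P : ℝ) ≤ φ / 6 * volIn G Finset.univ P ∧
    2 * (volIn G Finset.univ P : ℝ) ≤ volIn G Finset.univ Finset.univ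

lemma isPrunable_empty {V : Type*} [Fintype V] (G H : SimpleGraph V) (φ : ℝ) :
    IsPrunable G H φ ∅ := by
  simp only [IsPrunable, volIn, Finset.sum_empty, Nat.cast_zero, mul_zero, le_refl, true_and]
  positivity

lemma IsPrunable.anti {V : Type*} [Fintype V] {G H H' : SimpleGraph V} {φ : ℝ} {P : Finset V}
    (h : IsPrunable G H φ P) (hle : H' ≤ H) : IsPrunable G H' φ P :=
  ⟨le_trans (by exact_mod_cast volIn_mono hle subset_rfl subset_rfl) h.1, h.2⟩

lemma IsPrunable.volIn_le {V : Type*} [Fintype V] {G H : SimpleGraph V} {φ : ℝ} {P : Finset V}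
    (h : IsPrunable G H φ P) (hexp : IsVolExpander G φ) (i : ℕ)
    (hdel : ∀ U S, volIn G U S ≤ volIn H U S + 2 * i)
    (hpos : 0 < volIn G Finset.univ Finset.univ) :
    5 * (φ * volIn G Finset.univ P) ≤ 12 * (i : ℝ) := by
  rcases P.eq_empty_or_nonempty with rfl | hP
  · simp [volIn]
  obtain ⟨h1, h2⟩ := h
  have hpos' : (0 : ℝ) < volIn G Finset.univ Finset.univ := by exact_mod_cast hpos
  have hne : P ≠ Finset.univ := by
    rintro rfl
    linarith
  have h3 := hexp P hP hne
  have h4 : (volIn G (Finset.univ \ P) P : ℝ) ≤ volIn H (Finset.univ \ P) P + 2 * i := by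
    exact_mod_cast hdel _ _
  have h5 : (volIn G Finset.univ Finset.univ : ℝ) =
      volIn G Finset.univ (Finset.univ \ P) + volIn G Finset.univ P := by
    rw [← Nat.cast_add, ← volIn_union_left G _ Finset.sdiff_disjoint,
      Finset.sdiff_union_of_subset (Finset.subset_univ _)]
  rw [min_eq_left (by linarith)] at h3
  linarith

lemma IsPrunable.union {V : Type*} [Fintype V] {G H : SimpleGraph V} {φ : ℝ} {P S T : Finset V}
    (h : IsPrunable G H φ P) (hφ : 0 < φ) (hφ1 : φ ≤ 1) (hexp : IsVolExpander G φ)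
    (hHG : H ≤ G) (i : ℕ) (hdel : ∀ U S, volIn G U S ≤ volIn H U S + 2 * i)
    (hpos : 0 < volIn G Finset.univ Finset.univ)
    (hi : 20 * (i : ℝ) ≤ φ * volIn G Finset.univ Finset.univ)
    (hST : Disjoint S T) (hA : S ∪ T = Finset.univ \ P) (hS : S.Nonempty) (hT : T.Nonempty)
    (hmin : volIn H (Finset.univ \ P) S ≤ volIn H (Finset.univ \ P) T)
    (hcut : (volIn H T S : ℝ) ≤ φ / 6 * volIn H (Finset.univ \ P) S) :
    IsPrunable G H φ (P ∪ S) := by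
  have hvolP := h.volIn_le hexp i hdel hpos
  obtain ⟨h1, h2⟩ := h
  have hSA : S ⊆ Finset.univ \ P := hA ▸ Finset.subset_union_left
  have hTA : T ⊆ Finset.univ \ P := hA ▸ Finset.subset_union_right
  have hPA : Disjoint P (Finset.univ \ P) := Finset.disjoint_sdiff
  have hPS : Disjoint P S := hPA.mono_right hSA
  have hPT : Disjoint P T := hPA.mono_right hTA
  have hQT : Disjoint (P ∪ S) T := Finset.disjoint_union_left.2 ⟨hPT, hST⟩
  have huniv : P ∪ S ∪ T = Finset.univ := by
    rw [Finset.union_assoc, hA, Finset.union_sdiff_of_subset (Finset.subset_univ _)]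
  have hcompl : Finset.univ \ (P ∪ S) = T := by
    rw [← huniv, Finset.union_sdiff_cancel_left hQT]
  have hbQ : (volIn H T (P ∪ S) : ℝ) ≤ volIn H (Finset.univ \ P) P + volIn H T S := by
    rw [volIn_union_left H T hPS]
    push_cast
    gcongr
    exact volIn_mono le_rfl hTA subset_rfl
  have hvQ : (volIn G Finset.univ (P ∪ S) : ℝ) =
      volIn G Finset.univ P + volIn G Finset.univ S := by
    rw [volIn_union_left G _ hPS, Nat.cast_add]
  have hvV : (volIn G Finset.univ Finset.univ : ℝ) =
      volIn G Finset.univ (P ∪ S) + volIn G Finset.univ T := by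
    rw [← Nat.cast_add, ← volIn_union_left G _ hQT, huniv]
  have hSle : (volIn H (Finset.univ \ P) S : ℝ) ≤ volIn G Finset.univ S := by
    exact_mod_cast volIn_mono hHG (Finset.subset_univ _) subset_rfl
  have hTle : (volIn H (Finset.univ \ P) T : ℝ) ≤ volIn G Finset.univ T := by
    exact_mod_cast volIn_mono hHG (Finset.subset_univ _) subset_rfl
  have hmin' : (volIn H (Finset.univ \ P) S : ℝ) ≤ volIn H (Finset.univ \ P) T := by
    exact_mod_cast hmin
  refine ⟨?_, ?_⟩
  · rw [hcompl, hvQ]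
    nlinarith
  by_contra! hbig
  have hQne : P ∪ S ≠ Finset.univ := by
    intro hQ
    rw [hQ, Finset.sdiff_self] at hcompl
    exact hT.ne_empty hcompl.symm
  have hQ := hexp (P ∪ S) (hS.mono Finset.subset_union_right) hQne
  rw [hcompl, min_eq_right (by linarith)] at hQ
  have hdQ : (volIn G T (P ∪ S) : ℝ) ≤ volIn H T (P ∪ S) + 2 * i := by
    exact_mod_cast hdel _ _
  have hvS : (volIn G Finset.univ S : ℝ) ≤
      volIn H (Finset.univ \ P) P + volIn H (Finset.univ \ P) S + 2 * i := by
    have e1 := hdel Finset.univ S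
    have e2 := volIn_union_right H hPA S
    rw [Finset.union_sdiff_of_subset (Finset.subset_univ _)] at e2
    have e3 : volIn H P S ≤ volIn H (Finset.univ \ P) P := by
      rw [volIn_comm]
      exact volIn_mono le_rfl hSA subset_rfl
    have : volIn G Finset.univ S ≤
      volIn H (Finset.univ \ P) P + volIn H (Finset.univ \ P) S + 2 * i := by omega
    exact_mod_cast this
  have hx : φ * (volIn H (Finset.univ \ P) S : ℝ) ≤ φ * volIn G Finset.univ T :=
    mul_le_mul_of_nonneg_left (hmin'.trans hTle) hφ.le
  have hbP : (volIn H (Finset.univ \ P) P : ℝ) ≤ 2 / 5 * i := by linarith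
  have hvS' : φ * (volIn G Finset.univ S : ℝ) ≤
      φ * volIn H (Finset.univ \ P) S + 12 / 5 * (φ * i) := by
    have : (volIn G Finset.univ S : ℝ) ≤ volIn H (Finset.univ \ P) S + 12 / 5 * i := by linarith
    calc _ ≤ _ := mul_le_mul_of_nonneg_left this hφ.le
      _ = _ := by ring
  have hφi : φ * (i : ℝ) ≤ i := mul_le_of_le_one_left i.cast_nonneg hφ1
  have hφV : 0 < φ * (volIn G Finset.univ Finset.univ : ℝ) :=
    mul_pos hφ (by exact_mod_cast hpos)
  have hφsum : φ * (volIn G Finset.univ Finset.univ : ℝ) = φ * volIn G Finset.univ P +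
      φ * volIn G Finset.univ S + φ * volIn G Finset.univ T := by
    rw [hvV, hvQ]
    ring
  linarith

/-- A maximal prunable set leaves an expander behind. -/
lemma expander_of_maximal_isPrunable {V : Type*} [Fintype V] {G H : SimpleGraph V} {φ : ℝ}
    {P : Finset V} (hφ : 0 < φ) (hφ1 : φ ≤ 1) (hexp : IsVolExpander G φ)
    (hHG : H ≤ G) (i : ℕ) (hdel : ∀ U S, volIn G U S ≤ volIn H U S + 2 * i)
    (hpos : 0 < volIn G Finset.univ Finset.univ)
    (hi : 20 * (i : ℝ) ≤ φ * volIn G Finset.univ Finset.univ)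
    (hP : Maximal (IsPrunable G H φ) P) {S : Finset V} (hSA : S ⊆ Finset.univ \ P)
    (hS : S.Nonempty) (hSne : S ≠ Finset.univ \ P) :
    φ / 6 * min ((volIn H (Finset.univ \ P) S : ℝ))
        ((volIn H (Finset.univ \ P) ((Finset.univ \ P) \ S) : ℝ)) ≤
      ((crossIn H (Finset.univ \ P) S).card : ℝ) := by
  by_contra! hlt
  rw [card_crossIn] at hlt
  have not_union {S : Finset V} (hSA : S ⊆ Finset.univ \ P) (hS : S.Nonempty) :
      ¬ IsPrunable G H φ (P ∪ S) := fun h => by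
    obtain ⟨x, hx⟩ := hS
    exact (Finset.mem_sdiff.1 (hSA hx)).2
      (hP.2 h Finset.subset_union_left (Finset.mem_union_right _ hx))
  have hT : ((Finset.univ \ P) \ S).Nonempty :=
    Finset.sdiff_nonempty.2 fun h => hSne (hSA.antisymm h)
  rcases le_total (volIn H (Finset.univ \ P) S) (volIn H (Finset.univ \ P) ((Finset.univ \ P) \ S))
    with hle | hle
  · rw [min_eq_left (by exact_mod_cast hle)] at hlt
    exact not_union hSA hS (hP.1.union hφ hφ1 hexp hHG i hdel hpos hi Finset.disjoint_sdiff
      (Finset.union_sdiff_of_subset hSA) hS hT hle hlt.le)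
  · rw [min_eq_right (by exact_mod_cast hle), volIn_comm] at hlt
    exact not_union Finset.sdiff_subset hT (hP.1.union hφ hφ1 hexp hHG i hdel hpos hi
      Finset.sdiff_disjoint (Finset.sdiff_union_of_subset hSA) hT hS hle hlt.le)

/-- For a decreasing sequence of graphs there is an increasing sequence of prunable sets, each
maximal from index one on. -/
lemma exists_maximal_isPrunable_chain {V : Type*} [Fintype V] (G : SimpleGraph V) (φ : ℝ)
    (H : ℕ → SimpleGraph V) (hH : Antitone H) :
    ∃ P : ℕ → Finset V, P 0 = ∅ ∧ Monotone P ∧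
      ∀ i, 1 ≤ i → Maximal (IsPrunable G (H i) φ) (P i) := by
  have step (i : ℕ) (P : {P // IsPrunable G (H i) φ P}) :
      ∃ Q : {Q // IsPrunable G (H (i + 1)) φ Q},
        P.1 ⊆ Q.1 ∧ Maximal (IsPrunable G (H (i + 1)) φ) Q.1 := by
    obtain ⟨Q, hPQ, hQ⟩ := (Set.toFinite {Q | IsPrunable G (H (i + 1)) φ Q}).exists_le_maximal
      (P.2.anti (hH i.le_succ))
    exact ⟨⟨Q, hQ.1⟩, hPQ, hQ⟩
  choose next hsub hmax using step
  let P (i : ℕ) : {P // IsPrunable G (H i) φ P} :=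
    Nat.rec (motive := fun i => {P // IsPrunable G (H i) φ P}) ⟨∅, isPrunable_empty G (H 0) φ⟩
      next i
  refine ⟨fun i => (P i).1, rfl, monotone_nat_of_le_succ fun i => hsub i (P i), fun i hi => ?_⟩
  obtain ⟨j, rfl⟩ := Nat.exists_eq_add_of_le' hi
  exact hmax j (P j)

theorem expander_pruning_exists
    {V : Type*} [Fintype V] (G : SimpleGraph V) (φ : ℝ) (hφ : 0 < φ)
    (hexp : ∀ S : Finset V, S.Nonempty → S ≠ Finset.univ →
      φ * min ((volIn G Finset.univ S : ℝ)) ((volIn G Finset.univ (Finset.univ \ S) : ℝ)) ≤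
        ((edgeBoundary G S).card : ℝ))
    (k : ℕ) (e : Fin k → Sym2 V) (hinj : Function.Injective e)
    (hedge : ∀ j, e j ∈ G.edgeSet)
    (hk : (k : ℝ) ≤ φ * (2 * (G.edgeFinset.card : ℝ)) / 20)
    (Gi : ℕ → SimpleGraph V)
    (hGi : ∀ i, Gi i = G.deleteEdges {s | ∃ j : Fin k, (j : ℕ) < i ∧ e j = s}) :
    ∃ P : ℕ → Finset V, P 0 = ∅ ∧ (∀ i, i < k → P i ⊆ P (i + 1)) ∧
      ∀ i, 1 ≤ i → i ≤ k →
        ((volIn G Finset.univ (P i) : ℝ) ≤ 8 * (i : ℝ) / φ) ∧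
        ((edgeBoundary (Gi i) (P i)).card ≤ 4 * i) ∧
        (∀ S : Finset V, S ⊆ Finset.univ \ P i → S.Nonempty → S ≠ Finset.univ \ P i →
          φ / 6 * min ((volIn (Gi i) (Finset.univ \ P i) S : ℝ))
              ((volIn (Gi i) (Finset.univ \ P i) ((Finset.univ \ P i) \ S) : ℝ)) ≤
            ((crossIn (Gi i) (Finset.univ \ P i) S).card : ℝ)) := by
  have hexp' : IsVolExpander G φ := fun S hS hne => by
    rw [← card_edgeBoundary]
    exact hexp S hS hne
  have hanti : Antitone Gi := fun i j hij => by
    rw [hGi, hGi]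
    exact G.deleteEdges_anti fun s ⟨l, hl, hs⟩ => ⟨l, hl.trans_le hij, hs⟩
  obtain ⟨P, hP0, hPmono, hPmax⟩ := exists_maximal_isPrunable_chain G φ Gi hanti
  refine ⟨P, hP0, fun i _ => hPmono i.le_succ, fun i hi1 hik => ?_⟩
  have hle : Gi i ≤ G := by
    rw [hGi]
    exact G.deleteEdges_le _
  have hdel (U S : Finset V) : volIn G U S ≤ volIn (Gi i) U S + 2 * i := by
    let D : Finset (Sym2 V) := (Finset.univ.filter fun j : Fin k => (j : ℕ) < i).image e
    have hD : (D : Set (Sym2 V)) = {s | ∃ j : Fin k, (j : ℕ) < i ∧ e j = s} := by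
      ext s
      simp [D]
    have hcard : D.card ≤ i := by
      refine Finset.card_image_le.trans ?_
      rw [Fin.card_filter_val_lt]
      exact min_le_right _ _
    have := volIn_le_deleteEdges G D U S
    rw [hD, ← hGi] at this
    omega
  obtain ⟨u, v, huv⟩ : ∃ u v, G.Adj u v := by
    have h := hedge ⟨0, by omega⟩
    generalize e ⟨0, by omega⟩ = s at h
    induction s using Sym2.ind with
    | _ u v => exact ⟨u, v, h⟩
  have hpos : 0 < volIn G Finset.univ Finset.univ := by
    rw [volIn_eq_card, Finset.card_pos]
    exact ⟨(u, v), by simp [huv]⟩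
  have hi : 20 * (i : ℝ) ≤ φ * volIn G Finset.univ Finset.univ := by
    have : (i : ℝ) ≤ k := by exact_mod_cast hik
    rw [volIn_univ_univ]
    push_cast
    linarith
  have hvol := (hPmax i hi1).1.volIn_le hexp' i hdel hpos
  have hi0 : (0 : ℝ) ≤ i := i.cast_nonneg
  refine ⟨?_, ?_, fun S hSA hS hSne => expander_of_maximal_isPrunable hφ (hexp'.le_one huv) hexp'
    hle i hdel hpos hi (hPmax i hi1) hSA hS hSne⟩
  · rw [le_div_iff₀ hφ]
    linarith
  · rw [card_edgeBoundary]
    have := (hPmax i hi1).1.1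
    have : (volIn (Gi i) (Finset.univ \ P i) (P i) : ℝ) ≤ 4 * i := by linarith
    exact_mod_cast this
end
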